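/- arXiv:2301.09690 — 4 statements merged into one kernel-verified Lean document; each statement's English description precedes it below -/
import Mathlib

section
/- Let O ⊆ ℝ^{n_x} be an open set, let T : ℝ^{n_x} → ℝ^{n_z} (with n_z ≥ n_x) be continuously differentiable on O, and let X ⊆ O be compact. Assume (i) there exists p ∈ ℕ, p ≥ 1, such that for every z ∈ T(X) the set T⁻(z) := {x ∈ X : T(x) = z} has exactly p elements, and (ii) DT(x) is injective for every x ∈ X. Then for every z₀ ∈ T(X) there exist σ > 0 and k > 0 such that for all z_a, z_b ∈ B(z₀, σ) ∩ T(X), d_H(T⁻(z_a), T⁻(z_b)) ≤ k‖z_a − z_b‖; that is, the set-valued preimage map T⁻ is locally Lipschitz on T(X) with respect to the Hausdorff distance. -/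
/-- A map whose strict derivative at `x` is antilipschitz is antilipschitz near `x`. -/
theorem HasStrictFDerivAt.exists_dist_le_mul_dist {E F : Type*} [NormedAddCommGroup E]
    [NormedSpace ℝ E] [NormedAddCommGroup F] [NormedSpace ℝ F] {f : E → F} {f' : E →L[ℝ] F}
    {x : E} (hf : HasStrictFDerivAt f f' x) (hf' : ∃ C, AntilipschitzWith C f') :
    ∃ K : ℝ, ∃ U : Set E, IsOpen U ∧ x ∈ U ∧
      ∀ a ∈ U, ∀ b ∈ U, dist a b ≤ K * dist (f a) (f b) := by
  obtain ⟨C, hC⟩ := hf'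
  have hc : (0 : ℝ) < 1 / (2 * (C + 1)) := by positivity
  have hev := Asymptotics.IsLittleO.bound hf.isLittleO hc
  rw [nhds_prod_eq, Filter.eventually_iff, Filter.mem_prod_same_iff] at hev
  obtain ⟨t, ht, hmem⟩ := hev
  obtain ⟨U, hU, hUo, hxU⟩ := eventually_nhds_iff.mp ht
  refine ⟨2 * C, U, hUo, hxU, fun a ha b hb => ?_⟩
  have h₁ : ‖f a - f b - f' (a - b)‖ ≤ 1 / (2 * ((C : ℝ) + 1)) * ‖a - b‖ :=
    hmem (Set.mk_mem_prod (hU a ha) (hU b hb))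
  have h₂ : ‖a - b‖ ≤ C * ‖f' (a - b)‖ := by
    simpa [dist_eq_norm] using hC.le_mul_dist a b
  have h₃ : ‖f' (a - b)‖ ≤ ‖f a - f b‖ + ‖f a - f b - f' (a - b)‖ := by
    simpa using norm_sub_le (f a - f b) (f a - f b - f' (a - b))
  have h₄ : (C : ℝ) * (1 / (2 * (C + 1)) * ‖a - b‖) ≤ 1 / 2 * ‖a - b‖ := by
    rw [← mul_assoc]
    gcongr
    rw [mul_one_div, div_le_div_iff₀ (by positivity) (by norm_num)]
    linarith
  have h₅ := mul_le_mul_of_nonneg_left (h₃.trans (add_le_add_right h₁ _)) C.coe_nonneg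
  rw [dist_eq_norm, dist_eq_norm]
  linarith

/-- Points of a compact set whose image is close to `z₀` lie in any given open neighbourhood
of the fibre over `z₀`. -/
theorem IsCompact.exists_ball_preimage_subset {α β : Type*} [TopologicalSpace α] [MetricSpace β]
    {X U : Set α} {T : α → β} (hX : IsCompact X) (hT : ContinuousOn T X) (hU : IsOpen U)
    {z₀ : β} (h : ∀ x ∈ X, T x = z₀ → x ∈ U) :
    ∃ σ > 0, ∀ x ∈ X, T x ∈ Metric.ball z₀ σ → x ∈ U := by
  have hclosed : IsClosed (T '' (X \ U)) :=
    ((hX.diff hU).image_of_continuousOn (hT.mono Set.sdiff_subset)).isClosed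
  have hz : z₀ ∈ (T '' (X \ U))ᶜ := by
    rintro ⟨x, ⟨hxX, hxU⟩, hx⟩
    exact hxU (h x hxX hx)
  obtain ⟨σ, hσ, hsub⟩ := Metric.isOpen_iff.mp hclosed.isOpen_compl z₀ hz
  refine ⟨σ, hσ, fun x hx hxσ => ?_⟩
  by_contra hxU
  exact hsub hxσ ⟨x, ⟨hx, hxU⟩, rfl⟩

/-- If a locally antilipschitz map on a compact set has fibres of constant finite cardinality,
then its fibres depend locally Lipschitz continuously on the base point. -/
theorem IsCompact.exists_hausdorffDist_fiber_le {α β : Type*} [MetricSpace α]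
    [MetricSpace β] {X : Set α} {T : α → β} {p : ℕ} (hp : 1 ≤ p) (hX : IsCompact X)
    (hT : ContinuousOn T X) (hcard : ∀ z ∈ T '' X, ({x ∈ X | T x = z} : Set α).ncard = p)
    (hloc : ∀ x ∈ X, ∃ K : ℝ, ∃ U : Set α, IsOpen U ∧ x ∈ U ∧
      ∀ a ∈ U, ∀ b ∈ U, dist a b ≤ K * dist (T a) (T b))
    {z₀ : β} (hz₀ : z₀ ∈ T '' X) :
    ∃ σ > (0 : ℝ), ∃ k > (0 : ℝ),
      ∀ za ∈ Metric.ball z₀ σ ∩ T '' X, ∀ zb ∈ Metric.ball z₀ σ ∩ T '' X,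
        Metric.hausdorffDist {x ∈ X | T x = za} {x ∈ X | T x = zb} ≤ k * dist za zb := by
  have hfin : ∀ z ∈ T '' X, ({x ∈ X | T x = z} : Set α).Finite := fun z hz =>
    Set.finite_of_ncard_pos (by rw [hcard z hz]; exact hp)
  choose! K U hUo hxU hK using hloc
  obtain ⟨M, hM⟩ := ((hfin z₀ hz₀).image K).bddAbove
  have hKM : ∀ x ∈ X, T x = z₀ → K x ≤ max M 1 := fun x hx hxz =>
    (hM ⟨x, ⟨hx, hxz⟩, rfl⟩).trans (le_max_left _ _)
  obtain ⟨σ, hσ, hcover⟩ := hX.exists_ball_preimage_subset (z₀ := z₀) hT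
    (U := ⋃ x ∈ {x ∈ X | T x = z₀}, U x) (isOpen_biUnion fun x hx => hUo x hx.1)
    (fun x hx hxz => Set.mem_biUnion (x := x) ⟨hx, hxz⟩ (hxU x hx))
  have hcenter : ∀ x ∈ X, T x ∈ Metric.ball z₀ σ → ∃ y, (y ∈ X ∧ T y = z₀) ∧ x ∈ U y := by
    intro x hx hxσ
    simpa using hcover x hx hxσ
  choose! c hc hcU using hcenter
  have hsurj : ∀ z ∈ Metric.ball z₀ σ ∩ T '' X,
      c '' {x ∈ X | T x = z} = {x ∈ X | T x = z₀} := by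
    rintro z ⟨hzσ, hz⟩
    have hball : ∀ x, T x = z → T x ∈ Metric.ball z₀ σ := fun x hx => hx ▸ hzσ
    refine Set.eq_of_subset_of_ncard_le ?_ ?_ (hfin z₀ hz₀)
    · rintro _ ⟨x, ⟨hx, hxz⟩, rfl⟩
      exact hc x hx (hball x hxz)
    · rw [Set.InjOn.ncard_image, hcard z hz, hcard z₀ hz₀]
      rintro a ⟨ha, haz⟩ b ⟨hb, hbz⟩ hab
      have := hK (c a) (hc a ha (hball a haz)).1 a (hcU a ha (hball a haz)) b
        (hab ▸ hcU b hb (hball b hbz))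
      rw [haz, hbz, dist_self, mul_zero] at this
      exact dist_le_zero.mp this
  have hclose : ∀ za ∈ Metric.ball z₀ σ ∩ T '' X, ∀ zb ∈ Metric.ball z₀ σ ∩ T '' X,
      ∀ x ∈ {x ∈ X | T x = za}, ∃ y ∈ {x ∈ X | T x = zb},
        dist x y ≤ max M 1 * dist za zb := by
    rintro za hza zb hzb x ⟨hx, rfl⟩
    have hcx := hc x hx hza.1
    obtain ⟨y, ⟨hy, rfl⟩, hyx⟩ : c x ∈ c '' {x ∈ X | T x = zb} := by
      rw [hsurj zb hzb]
      exact hcx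
    refine ⟨y, ⟨hy, rfl⟩, (hK (c x) hcx.1 x (hcU x hx hza.1) y ?_).trans ?_⟩
    · exact hyx ▸ hcU y hy hzb.1
    · gcongr
      exact hKM (c x) hcx.1 hcx.2
  refine ⟨σ, hσ, max M 1, by positivity, fun za hza zb hzb =>
    Metric.hausdorffDist_le_of_mem_dist (by positivity) (hclose za hza zb hzb) ?_⟩
  rw [dist_comm za zb]
  exact hclose zb hzb za hza

/-- Under constant cardinality `p` of the preimages of points of `T(X)` and full rank of
the Jacobian of `T` on the compact set `X`, the set-valued preimage map
`T⁻(z) = {x ∈ X | T x = z}` is locally Lipschitz on `T(X)` for the Hausdorff distance. -/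
theorem preimage_locally_lipschitz {nx nz : ℕ} (hnz : nx ≤ nz) {p : ℕ} (hp : 1 ≤ p)
    (O : Set (EuclideanSpace ℝ (Fin nx))) (hO : IsOpen O)
    (T : EuclideanSpace ℝ (Fin nx) → EuclideanSpace ℝ (Fin nz))
    (hT : ContDiffOn ℝ 1 T O)
    (X : Set (EuclideanSpace ℝ (Fin nx))) (hX : IsCompact X) (hXO : X ⊆ O)
    (hcard : ∀ z ∈ T '' X, ({x ∈ X | T x = z} : Set _).ncard = p)
    (hrank : ∀ x ∈ X, Function.Injective (fderiv ℝ T x)) :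
    ∀ z₀ ∈ T '' X, ∃ σ > (0 : ℝ), ∃ k > (0 : ℝ),
      ∀ za ∈ Metric.ball z₀ σ ∩ T '' X, ∀ zb ∈ Metric.ball z₀ σ ∩ T '' X,
        Metric.hausdorffDist {x ∈ X | T x = za} {x ∈ X | T x = zb} ≤ k * ‖za - zb‖ := by
  intro z₀ hz₀
  have hd : ∀ x ∈ X, ContDiffAt ℝ 1 T x := fun x hx =>
    hT.contDiffAt (hO.mem_nhds (hXO hx))
  simp only [← dist_eq_norm]
  refine hX.exists_hausdorffDist_fiber_le hp (hT.continuousOn.mono hXO) hcard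
    (fun x hx => ?_) hz₀
  obtain ⟨C, -, hC⟩ := LinearMap.injective_iff_antilipschitz
    (fderiv ℝ T x : EuclideanSpace ℝ (Fin nx) →ₗ[ℝ] EuclideanSpace ℝ (Fin nz)) |>.mp (hrank x hx)
  exact ((hd x hx).hasStrictFDerivAt one_ne_zero).exists_dist_le_mul_dist ⟨C, hC⟩
end

section
/- Let O ⊆ ℝ^{n_x} be an open set, let T : ℝ^{n_x} → ℝ^{n_z} (with n_z ≥ n_x) be continuously differentiable on O, and let X ⊆ O be compact. Assume (i) there exists p ∈ ℕ, p ≥ 1, such that for every z ∈ T(X) the set T⁻(z) := {x ∈ X : T(x) = z} has exactly p elements, and (ii) DT(x) is injective for every x ∈ X. Then there exist L ≥ 0 and a set-valued map T^inv : ℝ^{n_z} → Set(ℝ^{n_x}) such that: (a) d_H(T^inv(z_a), T^inv(z_b)) ≤ L‖z_a − z_b‖ for all z_a, z_b ∈ ℝ^{n_z}; (b) T^inv(z) = T⁻(z) for every z ∈ T(X); and (c) for every z ∈ ℝ^{n_z}, T^inv(z) is a nonempty finite set containing at most p elements. -/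
open Set Filter Topology Metric

/-- The coordinatewise McShane extension, evaluated at `z`, of the inverse of `T` restricted to the
points of `X` at distance at most `ρ` from `a`. -/
noncomputable def localMcShane {ι Z : Type*} [Fintype ι] [MetricSpace Z]
    (T : EuclideanSpace ℝ ι → Z) (X : Set (EuclideanSpace ℝ ι)) (ρ L : ℝ)
    (a : EuclideanSpace ℝ ι) (z : Z) : EuclideanSpace ℝ ι :=
  WithLp.toLp 2 fun k => ⨅ x : ↥(X ∩ closedBall a ρ), (x.1 k + L * dist z (T x.1))

theorem HasStrictFDerivAt.exists_eventually_dist_le {E F : Type*}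
    [NormedAddCommGroup E] [NormedSpace ℝ E] [FiniteDimensional ℝ E]
    [NormedAddCommGroup F] [NormedSpace ℝ F] {f : E → F} {f' : E →L[ℝ] F} {x : E}
    (hf : HasStrictFDerivAt f f' x) (hinj : Function.Injective f') :
    ∃ K : ℝ, 0 < K ∧ ∀ᶠ q : E × E in 𝓝 (x, x), dist q.1 q.2 ≤ K * dist (f q.1) (f q.2) := by
  obtain ⟨K, hK, hanti⟩ := (LinearMap.injective_iff_antilipschitz (f' : E →ₗ[ℝ] F)).1 hinj
  have hK' : (0 : ℝ) < K := hK
  refine ⟨2 * K, by positivity, ?_⟩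
  filter_upwards [hf.isLittleO.def (c := 1 / (2 * K)) (by positivity)] with q hq
  have h1 : ‖q.1 - q.2‖ ≤ K * ‖f' (q.1 - q.2)‖ := by
    simpa [dist_eq_norm] using hanti.le_mul_dist q.1 q.2
  have h2 : ‖f' (q.1 - q.2)‖ ≤ ‖f q.1 - f q.2‖ + 1 / (2 * K) * ‖q.1 - q.2‖ := by
    have := norm_sub_norm_le (f' (q.1 - q.2)) (f q.1 - f q.2)
    rw [norm_sub_rev (f' _)] at this
    linarith
  rw [dist_eq_norm, dist_eq_norm]
  have h3 := mul_le_mul_of_nonneg_left h2 hK'.le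
  have h4 : K * (‖f q.1 - f q.2‖ + 1 / (2 * K) * ‖q.1 - q.2‖)
      = K * ‖f q.1 - f q.2‖ + ‖q.1 - q.2‖ / 2 := by
    field_simp
  linarith

theorem IsCompact.exists_dist_le_mul_dist_of_eventually {E F : Type*} [PseudoMetricSpace E]
    [PseudoMetricSpace F] {f : E → F} {X : Set E} (hX : IsCompact X)
    (h : ∀ x ∈ X, ∃ K : ℝ, 0 < K ∧
      ∀ᶠ q : E × E in 𝓝 (x, x), dist q.1 q.2 ≤ K * dist (f q.1) (f q.2)) :
    ∃ K ρ : ℝ, 0 < K ∧ 0 < ρ ∧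
      ∀ x ∈ X, ∀ y, dist x y ≤ ρ → dist x y ≤ K * dist (f x) (f y) := by
  refine hX.induction_on (p := fun S => ∃ K ρ : ℝ, 0 < K ∧ 0 < ρ ∧
      ∀ x ∈ S, ∀ y, dist x y ≤ ρ → dist x y ≤ K * dist (f x) (f y)) ?_ ?_ ?_ ?_
  · exact ⟨1, 1, one_pos, one_pos, by simp⟩
  · rintro s t hst ⟨K, ρ, hK, hρ, H⟩
    exact ⟨K, ρ, hK, hρ, fun x hx => H x (hst hx)⟩
  · rintro s t ⟨K, ρ, hK, hρ, H⟩ ⟨K', ρ', hK', hρ', H'⟩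
    refine ⟨max K K', min ρ ρ', lt_max_of_lt_left hK, lt_min hρ hρ', ?_⟩
    rintro x (hx | hx) y hxy
    · exact (H x hx y (hxy.trans (min_le_left _ _))).trans
        (mul_le_mul_of_nonneg_right (le_max_left _ _) dist_nonneg)
    · exact (H' x hx y (hxy.trans (min_le_right _ _))).trans
        (mul_le_mul_of_nonneg_right (le_max_right _ _) dist_nonneg)
  · intro x hx
    obtain ⟨K, hK, hev⟩ := h x hx
    obtain ⟨ε, hε, hball⟩ := Metric.eventually_nhds_iff.1 hev
    refine ⟨ball x (ε / 2), mem_nhdsWithin_of_mem_nhds (ball_mem_nhds _ (by positivity)),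
      K, ε / 3, hK, by positivity, fun y hy w hyw => ?_⟩
    have hy' : dist y x < ε / 2 := hy
    refine hball (y := (y, w)) ?_
    rw [Prod.dist_eq]
    refine max_lt (by simpa using hy'.trans (by linarith)) ?_
    have := dist_triangle w y x
    rw [dist_comm w y] at this
    change dist w x < ε
    linarith

theorem IsCompact.exists_fiber_dist_lt {E F : Type*} [PseudoMetricSpace E] [MetricSpace F]
    {f : E → F} {X : Set E} (hX : IsCompact X) (hf : ContinuousOn f X) (z : F) {η : ℝ} (hη : 0 < η) :
    ∃ ε > 0, ∀ b ∈ X, dist (f b) z < ε → ∃ x ∈ X, f x = z ∧ dist b x < η := by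
  have hS : IsCompact (X \ thickening η {x ∈ X | f x = z}) := hX.diff isOpen_thickening
  have hcl := (hS.image_of_continuousOn (hf.mono sdiff_subset)).isClosed
  have hz : z ∉ f '' (X \ thickening η {x ∈ X | f x = z}) := by
    rintro ⟨x, ⟨hx, hx'⟩, hxz⟩
    exact hx' (self_subset_thickening hη _ ⟨hx, hxz⟩)
  obtain ⟨ε, hε, hball⟩ := Metric.isOpen_iff.1 hcl.isOpen_compl z hz
  refine ⟨ε, hε, fun b hb hbz => ?_⟩
  by_contra hcon
  refine hball (show f b ∈ ball z ε from hbz) ⟨b, ⟨hb, fun hmem => hcon ?_⟩, rfl⟩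
  obtain ⟨x, ⟨hx, hxz⟩, hbx⟩ := mem_thickening_iff.1 hmem
  exact ⟨x, hx, hxz, hbx⟩

/-- If the fibers of `f` over `f '' X` all have `p ≥ 1` elements and `f` is injective at a
uniform small scale, then nearby fibers are uniformly close. -/
theorem IsCompact.exists_fiber_dist_le {E F : Type*} [PseudoMetricSpace E] [MetricSpace F]
    {f : E → F} {X : Set E} (hX : IsCompact X) (hf : ContinuousOn f X) {p : ℕ} (hp : 1 ≤ p)
    (hcard : ∀ z ∈ f '' X, ({x ∈ X | f x = z} : Set _).ncard = p) {η : ℝ} (hη : 0 < η)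
    (hinj : ∀ x ∈ X, ∀ y ∈ X, dist x y ≤ 2 * η → f x = f y → x = y) :
    ∃ r > 0, ∀ b ∈ X, ∀ z ∈ f '' X, dist (f b) z < r → ∃ a ∈ X, f a = z ∧ dist a b ≤ 2 * η := by
  have key : ∃ r > 0, ∀ b ∈ X, f b ∈ f '' X → ∀ z ∈ f '' X, dist (f b) z < r →
      ∃ a ∈ X, f a = z ∧ dist a b ≤ 2 * η := by
    refine (hX.image_of_continuousOn hf).induction_on (p := fun S => ∃ r > 0, ∀ b ∈ X, f b ∈ S →
      ∀ z ∈ f '' X, dist (f b) z < r → ∃ a ∈ X, f a = z ∧ dist a b ≤ 2 * η) ?_ ?_ ?_ ?_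
    · exact ⟨1, one_pos, by simp⟩
    · rintro s t hst ⟨r, hr, H⟩
      exact ⟨r, hr, fun b hb hbs => H b hb (hst hbs)⟩
    · rintro s t ⟨r, hr, H⟩ ⟨r', hr', H'⟩
      refine ⟨min r r', lt_min hr hr', ?_⟩
      rintro b hb (hbs | hbt) z hz hbz
      · exact H b hb hbs z hz (hbz.trans_le (min_le_left _ _))
      · exact H' b hb hbt z hz (hbz.trans_le (min_le_right _ _))
    · intro z₀ hz₀
      obtain ⟨ε, hε, hnear⟩ := hX.exists_fiber_dist_lt hf z₀ hη
      refine ⟨ball z₀ (ε / 2), mem_nhdsWithin_of_mem_nhds (ball_mem_nhds _ (by positivity)),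
        ε / 2, by positivity, fun b hb hbz₀ z hz hbz => ?_⟩
      have hbz₀' : dist (f b) z₀ < ε / 2 := hbz₀
      have hzz₀ : dist z z₀ < ε := by
        have := dist_triangle_left z z₀ (f b)
        linarith
      obtain ⟨x, hx, hxz₀, hbx⟩ := hnear b hb (by linarith)
      have hnear' : ∀ a ∈ {x ∈ X | f x = z}, ∃ y ∈ X, f y = z₀ ∧ dist a y < η :=
        fun a ha => hnear a ha.1 (by rw [ha.2]; exact hzz₀)
      choose! g hgX hgz hgd using hnear'
      obtain ⟨a, ha, hxa⟩ := Set.surj_on_of_inj_on_of_ncard_le (s := {x ∈ X | f x = z})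
        (t := {x ∈ X | f x = z₀}) (fun a _ => g a) (fun a ha => ⟨hgX a ha, hgz a ha⟩)
        (fun a a' ha ha' h => hinj a ha.1 a' ha'.1 (by
          have h1 := hgd a ha
          have h2 := hgd a' ha'
          change g a = g a' at h
          rw [← h] at h2
          have := dist_triangle_right a a' (g a)
          linarith) (ha.2.trans ha'.2.symm))
        (by rw [hcard z hz, hcard z₀ hz₀])
        (Set.finite_of_ncard_pos (by rw [hcard z₀ hz₀]; omega)) x ⟨hx, hxz₀⟩
      refine ⟨a, ha.1, ha.2, ?_⟩
      have h1 := hgd a ha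
      rw [← hxa] at h1
      have := dist_triangle_right a b x
      linarith
  obtain ⟨r, hr, H⟩ := key
  exact ⟨r, hr, fun b hb => H b hb (mem_image_of_mem f hb)⟩

theorem EuclideanSpace.dist_le_sqrt_card_mul {ι : Type*} [Fintype ι] {x y : EuclideanSpace ℝ ι}
    {M : ℝ} (hM : 0 ≤ M) (h : ∀ k, dist (x k) (y k) ≤ M) :
    dist x y ≤ √(Fintype.card ι) * M := by
  rw [EuclideanSpace.dist_eq]
  refine Real.sqrt_le_iff.2 ⟨by positivity, ?_⟩
  rw [mul_pow, Real.sq_sqrt (by positivity)]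
  calc ∑ i, dist (x i) (y i) ^ 2 ≤ ∑ _i : ι, M ^ 2 :=
        Finset.sum_le_sum fun i _ => pow_le_pow_left₀ dist_nonneg (h i) 2
    _ = Fintype.card ι * M ^ 2 := by simp

section localMcShane

variable {ι Z : Type*} [Fintype ι] [MetricSpace Z] {T : EuclideanSpace ℝ ι → Z}
  {X : Set (EuclideanSpace ℝ ι)} {ρ L K : ℝ} {a b : EuclideanSpace ℝ ι} {z : Z}

theorem EuclideanSpace.sub_dist_le_apply (x a : EuclideanSpace ℝ ι) (k : ι) :
    a k - dist x a ≤ x k := by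
  have h := (PiLp.dist_apply_le x a k).trans' (le_of_eq (Real.dist_eq _ _).symm)
  linarith [(abs_le.1 h).1]

theorem localMcShane_bddBelow (hL : 0 ≤ L) (k : ι) :
    BddBelow (range fun x : ↥(X ∩ closedBall a ρ) => x.1 k + L * dist z (T x.1)) := by
  refine ⟨a k - ρ, ?_⟩
  rintro _ ⟨⟨x, hx, hxa⟩, rfl⟩
  have h1 := EuclideanSpace.sub_dist_le_apply x a k
  have h2 : dist x a ≤ ρ := hxa
  have h3 : 0 ≤ L * dist z (T x) := by positivity
  change _ ≤ x k + L * dist z (T x)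
  linarith

theorem localMcShane_apply_le (hL : 0 ≤ L) {x : EuclideanSpace ℝ ι} (hx : x ∈ X)
    (hxa : dist x a ≤ ρ) (k : ι) : localMcShane T X ρ L a z k ≤ x k + L * dist z (T x) :=
  ciInf_le (localMcShane_bddBelow hL k) (⟨x, hx, hxa⟩ : ↥(X ∩ closedBall a ρ))

theorem le_localMcShane_apply (hρ : 0 ≤ ρ) (ha : a ∈ X) {k : ι} {m : ℝ}
    (h : ∀ x ∈ X, dist x a ≤ ρ → m ≤ x k + L * dist z (T x)) :
    m ≤ localMcShane T X ρ L a z k := by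
  have : Nonempty ↥(X ∩ closedBall a ρ) := ⟨⟨a, ha, mem_closedBall_self hρ⟩⟩
  exact le_ciInf fun x => h x.1 x.2.1 x.2.2

theorem dist_localMcShane_le (hρ : 0 ≤ ρ) (hL : 0 ≤ L) (ha : a ∈ X) (z w : Z) :
    dist (localMcShane T X ρ L a z) (localMcShane T X ρ L a w)
      ≤ √(Fintype.card ι) * (L * dist z w) := by
  have key : ∀ z w k, localMcShane T X ρ L a z k - L * dist z w ≤ localMcShane T X ρ L a w k := by
    refine fun z w k => le_localMcShane_apply hρ ha fun x hx hxa => ?_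
    have h1 := localMcShane_apply_le (T := T) (z := z) hL hx hxa k
    have h2 := mul_le_mul_of_nonneg_left (dist_triangle z w (T x)) hL
    linarith
  refine EuclideanSpace.dist_le_sqrt_card_mul (by positivity) fun k => ?_
  have h1 := key z w k
  have h2 := key w z k
  rw [dist_comm w z] at h2
  rw [Real.dist_eq, abs_le]
  constructor <;> linarith

theorem localMcShane_self (hρ : 0 ≤ ρ) (hK : 0 ≤ K) (ha : a ∈ X)
    (hT : ∀ x ∈ X, dist x a ≤ ρ → dist x a ≤ K * dist (T x) (T a)) :
    localMcShane T X ρ (2 * K) a (T a) = a := by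
  ext k
  apply le_antisymm
  · simpa using localMcShane_apply_le (T := T) (z := T a) (L := 2 * K) (by positivity) ha
      (by simpa using hρ) k
  · refine le_localMcShane_apply hρ ha fun x hx hxa => ?_
    have h1 := hT x hx hxa
    have h2 := EuclideanSpace.sub_dist_le_apply x a k
    rw [dist_comm (T x)] at h1
    have h3 : 0 ≤ K * dist (T a) (T x) := by positivity
    linarith

/-- The values of `localMcShane` near `T b` do not depend on small changes of the base point. -/
theorem localMcShane_congr {s : ℝ} (hρ : 0 ≤ ρ) (hK : 0 ≤ K)
    (hT : ∀ x ∈ X, ∀ y ∈ X, dist x y ≤ ρ → dist x y ≤ K * dist (T x) (T y))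
    (hs : 8 * K * s ≤ ρ) (ha : a ∈ X) (hb : b ∈ X) (hab : 2 * dist a b ≤ ρ)
    (hza : dist z (T a) ≤ s) (hzb : dist z (T b) ≤ s) :
    localMcShane T X ρ (2 * K) a z = localMcShane T X ρ (2 * K) b z := by
  have key : ∀ a ∈ X, ∀ b ∈ X, 2 * dist a b ≤ ρ → dist z (T b) ≤ s → ∀ k,
      localMcShane T X ρ (2 * K) a z k ≤ localMcShane T X ρ (2 * K) b z k := by
    intro a ha b hb hab hzb k
    refine le_localMcShane_apply hρ hb fun x hx hxb => ?_
    by_cases hxa : dist x a ≤ ρ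
    · exact localMcShane_apply_le (by positivity) hx hxa k
    · have h1 := localMcShane_apply_le (T := T) (z := z) (L := 2 * K) (ρ := ρ) (a := a)
        (by positivity) hb (by rw [dist_comm]; linarith [dist_nonneg (x := a) (y := b)]) k
      have h2 := hT x hx b hb hxb
      have h3 := EuclideanSpace.sub_dist_le_apply x b k
      have h4 := dist_triangle_right x a b
      have h5 := mul_le_mul_of_nonneg_left (dist_triangle_left (T x) (T b) z) hK
      have h6 := mul_le_mul_of_nonneg_left hzb hK
      linarith
  ext k
  exact le_antisymm (key a ha b hb hab hzb k)
    (key b hb a ha (by rwa [dist_comm]) hza k)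

end localMcShane

/-- Under constant cardinality `p` of the preimages and full rank of the Jacobian of `T` on
the compact set `X`, the set-valued preimage map `T⁻` admits a globally Lipschitz
(in the Hausdorff sense) set-valued extension `T^inv` to all of `ℝ^{n_z}`, whose values are
nonempty finite sets with at most `p` elements. -/
theorem exists_lipschitz_setvalued_extension {nx nz : ℕ} (hnz : nx ≤ nz) {p : ℕ} (hp : 1 ≤ p)
    (O : Set (EuclideanSpace ℝ (Fin nx))) (hO : IsOpen O)
    (T : EuclideanSpace ℝ (Fin nx) → EuclideanSpace ℝ (Fin nz))
    (hT : ContDiffOn ℝ 1 T O)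
    (X : Set (EuclideanSpace ℝ (Fin nx))) (hX : IsCompact X) (hXO : X ⊆ O)
    (hcard : ∀ z ∈ T '' X, ({x ∈ X | T x = z} : Set _).ncard = p)
    (hrank : ∀ x ∈ X, Function.Injective (fderiv ℝ T x)) :
    ∃ (L : ℝ) (Tinv : EuclideanSpace ℝ (Fin nz) → Set (EuclideanSpace ℝ (Fin nx))),
      0 ≤ L ∧
      (∀ za zb, Metric.hausdorffDist (Tinv za) (Tinv zb) ≤ L * ‖za - zb‖) ∧
      (∀ z ∈ T '' X, Tinv z = {x ∈ X | T x = z}) ∧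
      (∀ z, (Tinv z).Nonempty ∧ (Tinv z).Finite ∧ (Tinv z).ncard ≤ p) := by
  rcases X.eq_empty_or_nonempty with rfl | hne
  · exact ⟨0, fun _ => {0}, le_rfl, by simp, by simp, fun z => ⟨by simp, by simp, by simpa⟩⟩
  have hcont : ContinuousOn T X := hT.continuousOn.mono hXO
  obtain ⟨K, ρ, hK, hρ, hlow⟩ := hX.exists_dist_le_mul_dist_of_eventually (f := T) fun x hx =>
    ((hT.contDiffAt (hO.mem_nhds (hXO hx))).hasStrictFDerivAt
      one_ne_zero).exists_eventually_dist_le (hrank x hx)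
  obtain ⟨r₁, hr₁, hfib⟩ := hX.exists_fiber_dist_le hcont hp hcard (η := ρ / 4) (by positivity)
    fun x hx y _ hxy hTxy => by
      have := hlow x hx y (by linarith)
      rw [hTxy, dist_self, mul_zero] at this
      exact dist_le_zero.1 this
  obtain ⟨r, hr, hrr₁, hrρ⟩ : ∃ r > 0, 5 * r < r₁ ∧ 8 * K * (3 * r) ≤ ρ := by
    refine ⟨min (r₁ / 6) (ρ / (24 * K)), by positivity, ?_, ?_⟩
    · linarith [min_le_left (r₁ / 6) (ρ / (24 * K))]
    · have := min_le_right (r₁ / 6) (ρ / (24 * K))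
      rw [le_div_iff₀ (by positivity)] at this
      linarith
  have hYc : IsCompact (T '' X) := hX.image_of_continuousOn hcont
  have hproj : ∀ z, ∃ y ∈ T '' X, infDist z (T '' X) = dist z y :=
    fun z => hYc.exists_infDist_eq_dist (hne.image T) z
  choose π hπ hπd using hproj
  set d : EuclideanSpace ℝ (Fin nz) → ℝ := fun z => infDist z (T '' X)
  have hd0 : ∀ z, 0 ≤ d z := fun z => infDist_nonneg
  have hdl : ∀ z w, d z ≤ d w + dist z w := fun z w => infDist_le_infDist_add_dist
  set c : EuclideanSpace ℝ (Fin nz) → ℝ := fun z => max 0 (1 - d z / r) with hc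
  have hc0 : ∀ z, 0 ≤ c z := fun z => le_max_left _ _
  have hc1 : ∀ z, c z ≤ 1 := fun z => max_le zero_le_one (by
    have := div_nonneg (hd0 z) hr.le
    linarith)
  have hcz : ∀ z, r ≤ d z → c z = 0 := fun z hz => max_eq_left (by
    have := (one_le_div hr).2 hz
    linarith)
  have hcl : ∀ z w, |c z - c w| ≤ dist z w / r := by
    have key : ∀ z w, c z ≤ c w + dist z w / r := by
      intro z w
      refine max_le (add_nonneg (hc0 w) (by positivity)) ?_
      have h1 : d w / r ≤ d z / r + dist z w / r := by
        rw [← add_div, dist_comm]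
        exact div_le_div_of_nonneg_right (hdl w z) hr.le
      have h2 : 1 - d w / r ≤ c w := le_max_right _ _
      linarith
    intro z w
    have h1 := key z w
    have h2 := key w z
    rw [dist_comm] at h2
    rw [abs_le]
    constructor <;> linarith
  obtain ⟨B₀, hB₀⟩ := hX.isBounded.exists_norm_le
  set G : EuclideanSpace ℝ (Fin nx) → EuclideanSpace ℝ (Fin nz) → EuclideanSpace ℝ (Fin nx) :=
    localMcShane T X ρ (2 * K)
  set C : ℝ := √(Fintype.card (Fin nx)) * (2 * K) with hC
  have hC0 : 0 ≤ C := by positivity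
  have hGl : ∀ a ∈ X, ∀ z w, dist (G a z) (G a w) ≤ C * dist z w := fun a ha z w => by
    rw [hC, mul_assoc]
    exact dist_localMcShane_le hρ.le (by positivity) ha z w
  have hGs : ∀ a ∈ X, G a (T a) = a := fun a ha =>
    localMcShane_self hρ.le hK.le ha fun x hx => hlow x hx a
  set B : ℝ := B₀ + C * (2 * r)
  have hGB : ∀ a ∈ X, ∀ z, dist z (T a) ≤ 2 * r → ‖G a z‖ ≤ B := by
    intro a ha z hz
    have h1 := (hGl a ha z (T a)).trans (mul_le_mul_of_nonneg_left hz hC0)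
    rw [hGs a ha, dist_eq_norm] at h1
    have h2 := norm_sub_norm_le (G a z) a
    linarith [hB₀ a ha]
  have hB0 : 0 ≤ B := by
    obtain ⟨a, ha⟩ := hne
    exact (norm_nonneg _).trans (hGB a ha (T a) (by rw [dist_self]; positivity))
  have hcGB : ∀ z, ∀ a ∈ X, T a = π z → ‖c z • G a z‖ ≤ B := by
    intro z a ha haz
    rcases le_or_gt r (d z) with h | h
    · simpa [hcz z h] using hB0
    · have h1 := hGB a ha z (by rw [haz, ← hπd]; change d z ≤ _; linarith)
      rw [norm_smul, Real.norm_of_nonneg (hc0 z)]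
      exact (mul_le_of_le_one_left (norm_nonneg _) (hc1 z)).trans h1
  set M : ℝ := 2 * B / r + C with hM
  have hfiber : ∀ z, ({x ∈ X | T x = π z} : Set _).Nonempty := fun z => hπ z
  have main : ∀ z w, ∀ a ∈ X, T a = π z → ∃ b ∈ X, T b = π w ∧
      dist (c z • G a z) (c w • G b w) ≤ M * dist z w := by
    intro z w a ha haz
    have hMr : 2 * B / r * dist z w ≤ M * dist z w :=
      mul_le_mul_of_nonneg_right (by linarith) dist_nonneg
    rcases le_or_gt r (dist z w) with hzw | hzw
    · obtain ⟨b, hb, hbw⟩ := hfiber w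
      refine ⟨b, hb, hbw, le_trans ?_ hMr⟩
      have h1 := hcGB z a ha haz
      have h2 := hcGB w b hb hbw
      have h3 : 2 * B ≤ 2 * B / r * dist z w := by
        rw [div_mul_eq_mul_div, le_div_iff₀ hr]
        exact mul_le_mul_of_nonneg_left hzw (by positivity)
      exact (dist_le_norm_add_norm _ _).trans (by linarith)
    rcases le_or_gt (2 * r) (d z) with hdz | hdz
    · obtain ⟨b, hb, hbw⟩ := hfiber w
      refine ⟨b, hb, hbw, ?_⟩
      rw [hcz z (by linarith), hcz w (by linarith [hdl z w])]
      simpa using by positivity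
    rcases le_or_gt (2 * r) (d w) with hdw | hdw
    · obtain ⟨b, hb, hbw⟩ := hfiber w
      refine ⟨b, hb, hbw, ?_⟩
      have := hdl w z
      rw [dist_comm] at this
      rw [hcz z (by linarith), hcz w (by linarith)]
      simpa using by positivity
    have hza : dist z (T a) < 2 * r := by rw [haz, ← hπd]; exact hdz
    have hwπ : dist w (π w) < 2 * r := by rw [← hπd]; exact hdw
    have hwa : dist w (T a) < 3 * r := by
      have := dist_triangle_left w (T a) z
      linarith
    obtain ⟨b, hb, hbw, hba⟩ := hfib a ha (π w) (hπ w) (by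
      have := dist_triangle_left (T a) (π w) w
      linarith)
    refine ⟨b, hb, hbw, ?_⟩
    have hGab : G b w = G a w := localMcShane_congr hρ.le hK.le
      (fun x hx y _ => hlow x hx y) hrρ hb ha (by linarith) (by rw [hbw]; linarith) hwa.le
    have h1 := hGB a ha z hza.le
    have h2 := hGl a ha z w
    have h3 := hcl z w
    have h4 : c z • G a z - c w • G a w = (c z - c w) • G a z + c w • (G a z - G a w) := by
      module
    rw [hGab, dist_eq_norm, h4]
    calc ‖(c z - c w) • G a z + c w • (G a z - G a w)‖
        ≤ |c z - c w| * ‖G a z‖ + c w * dist (G a z) (G a w) := by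
          refine (norm_add_le _ _).trans (le_of_eq ?_)
          rw [norm_smul, norm_smul, Real.norm_eq_abs, Real.norm_of_nonneg (hc0 w), dist_eq_norm]
      _ ≤ dist z w / r * B + 1 * (C * dist z w) := by
          gcongr
          exact hc1 w
      _ = (B / r + C) * dist z w := by ring
      _ ≤ M * dist z w := by
          refine mul_le_mul_of_nonneg_right ?_ dist_nonneg
          have : 0 ≤ B / r := by positivity
          rw [hM, mul_div_assoc]
          linarith
  have hfin : ∀ z, ({x ∈ X | T x = π z} : Set _).Finite := fun z =>
    Set.finite_of_ncard_pos (by rw [hcard _ (hπ z)]; omega)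
  refine ⟨M, fun z => (fun a => c z • G a z) '' {x ∈ X | T x = π z}, by positivity,
    fun z w => ?_, fun z hz => ?_, fun z => ⟨(hfiber z).image _, (hfin z).image _, ?_⟩⟩
  · rw [← dist_eq_norm]
    refine hausdorffDist_le_of_mem_dist (by positivity) ?_ ?_
    · rintro _ ⟨a, ⟨ha, haz⟩, rfl⟩
      obtain ⟨b, hb, hbw, h⟩ := main z w a ha haz
      exact ⟨_, ⟨b, ⟨hb, hbw⟩, rfl⟩, h⟩
    · rintro _ ⟨a, ⟨ha, haz⟩, rfl⟩
      obtain ⟨b, hb, hbw, h⟩ := main w z a ha haz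
      rw [dist_comm w z] at h
      exact ⟨_, ⟨b, ⟨hb, hbw⟩, rfl⟩, h⟩
  · have hdz : d z = 0 := infDist_zero_of_mem hz
    have hπz : π z = z := by
      have h := hπd z
      change d z = _ at h
      rw [hdz] at h
      exact (dist_eq_zero.1 h.symm).symm
    have hcz1 : c z = 1 := by simp [hc, hdz]
    have hid : ∀ a ∈ {x ∈ X | T x = z}, c z • G a z = a := by
      rintro a ⟨ha, rfl⟩
      rw [hcz1, one_smul, hGs a ha]
    change (fun a => c z • G a z) '' {x ∈ X | T x = π z} = _
    rw [hπz, Set.image_congr hid, Set.image_id']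
  · exact (Set.ncard_image_le (hfin z)).trans (hcard _ (hπ z)).le
end

section
/- Let C := {z ∈ ℝ² : |z| = 1} be the unit circle, and define φ : [0,1) → C by φ(t) := (sin(2πt), cos(2πt)) with (continuous-except-at-one-point) inverse φ⁻(z) = arg(z)/(2π), where arg : C → [0, 2π). Define f, g : [0,1) → ℝ² by f(t) := (2 − t, 4 − t) and g(t) := (1 + t, 3 + t e^{t−1}), and the set-valued map T⁻ : C → Set(ℝ²) by T⁻(z) := {f(φ⁻(z)), g(φ⁻(z))}. Then: (i) f(t) ≠ g(t) for all t ∈ [0,1), so card(T⁻(z)) = 2 for all z ∈ C; (ii) T⁻ is continuous on all of C with respect to the Hausdorff distance (including at z = (1,0), because f(t) → g(0) and g(t) → f(0) as t → 1); and (iii) T⁻ does not split: there exist no continuous functions t₁, t₂ : C → ℝ² such that T⁻(z) = {t₁(z), t₂(z)} for all z ∈ C. -/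
theorem Metric.hausdorffDist_pair_le {α : Type*} [PseudoMetricSpace α] (a b c d : α) :
    Metric.hausdorffDist ({a, b} : Set α) {c, d} ≤ max (dist a c) (dist b d) := by
  refine Metric.hausdorffDist_le_of_mem_dist (le_max_of_le_left dist_nonneg) ?_ ?_
  · rintro x (rfl | rfl)
    · exact ⟨c, by simp, le_max_left _ _⟩
    · exact ⟨d, by simp, le_max_right _ _⟩
  · rintro x (rfl | rfl)
    · exact ⟨a, by simp, by rw [dist_comm]; exact le_max_left _ _⟩
    · exact ⟨b, by simp, by rw [dist_comm]; exact le_max_right _ _⟩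

theorem exists_int_sub_eq_of_sin_cos_two_pi_mul_eq {t s : ℝ}
    (hsin : Real.sin (2 * Real.pi * t) = Real.sin (2 * Real.pi * s))
    (hcos : Real.cos (2 * Real.pi * t) = Real.cos (2 * Real.pi * s)) :
    ∃ n : ℤ, t - s = n := by
  have h : Real.cos (2 * Real.pi * t - 2 * Real.pi * s) = 1 := by
    rw [Real.cos_sub, hsin, hcos]
    nlinarith [Real.sin_sq_add_cos_sq (2 * Real.pi * s)]
  obtain ⟨n, hn⟩ := (Real.cos_eq_one_iff _).1 h
  refine ⟨n, mul_left_cancel₀ Real.two_pi_pos.ne' ?_⟩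
  linarith

/-- The counterexample on the unit circle: the 2-valued map
`T⁻(z) = {f(arg z/2π), g(arg z/2π)}` with `f(t) = (2−t, 4−t)` and
`g(t) = (1+t, 3+t e^{t−1})` has constant cardinality 2, is continuous on the whole circle
in the Hausdorff-distance sense, and yet does not split into two continuous branches. -/
theorem circle_two_valued_map_does_not_split
    (C : Set (ℝ × ℝ)) (hC : C = {z : ℝ × ℝ | z.1 ^ 2 + z.2 ^ 2 = 1})
    (φ : ℝ → ℝ × ℝ)
    (hφ : ∀ t, φ t = (Real.sin (2 * Real.pi * t), Real.cos (2 * Real.pi * t)))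
    (arg : ℝ × ℝ → ℝ)
    (harg_mem : ∀ z ∈ C, arg z ∈ Set.Ico 0 (2 * Real.pi))
    (harg_inv : ∀ z ∈ C, φ (arg z / (2 * Real.pi)) = z)
    (f g : ℝ → ℝ × ℝ)
    (hf : ∀ t, f t = (2 - t, 4 - t))
    (hg : ∀ t, g t = (1 + t, 3 + t * Real.exp (t - 1)))
    (Tminus : ℝ × ℝ → Set (ℝ × ℝ))
    (hTminus : ∀ z, Tminus z = {f (arg z / (2 * Real.pi)), g (arg z / (2 * Real.pi))}) :
    (∀ t ∈ Set.Ico (0 : ℝ) 1, f t ≠ g t) ∧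
    (∀ z ∈ C, (Tminus z).ncard = 2) ∧
    (∀ zstar ∈ C, ∀ ε > (0 : ℝ), ∃ δ > (0 : ℝ), ∀ z ∈ C, dist z zstar < δ →
      Metric.hausdorffDist (Tminus z) (Tminus zstar) < ε) ∧
    ¬ ∃ t₁ t₂ : ℝ × ℝ → ℝ × ℝ, ContinuousOn t₁ C ∧ ContinuousOn t₂ C ∧
      ∀ z ∈ C, Tminus z = {t₁ z, t₂ z} := by
  have hpi := Real.two_pi_pos
  have hfg : ∀ t, f t ≠ g t := by
    intro t h
    rw [hf, hg, Prod.mk.injEq] at h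
    obtain ⟨h₁, h₂⟩ := h
    obtain rfl : t = 1 / 2 := by linarith
    have : Real.exp (1 / 2 - 1) < 1 :=
      (Real.exp_lt_exp.2 (by norm_num)).trans_eq Real.exp_zero
    linarith
  have hfc : Continuous f := by
    rw [funext hf]; fun_prop
  have hgc : Continuous g := by
    rw [funext hg]; fun_prop
  have hφc : Continuous φ := by
    rw [funext hφ]; fun_prop
  have hf1 : f 1 = g 0 := by rw [hf, hg]; norm_num
  have hg1 : g 1 = f 0 := by rw [hf, hg]; norm_num
  have hφ1 : φ 1 = φ 0 := by simp [hφ]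
  have hφC : ∀ t, φ t ∈ C := fun t => by simp [hC, hφ]
  have hmem : ∀ z ∈ C, arg z / (2 * Real.pi) ∈ Set.Ico (0 : ℝ) 1 := fun z hz =>
    ⟨div_nonneg (harg_mem z hz).1 hpi.le, (div_lt_one hpi).2 (harg_mem z hz).2⟩
  have hinj : ∀ t ∈ Set.Icc (0 : ℝ) 1, ∀ s ∈ Set.Ico (0 : ℝ) 1, φ t = φ s →
      t = s ∨ (t = 1 ∧ s = 0) := by
    intro t ht s hs h
    rw [hφ, hφ, Prod.mk.injEq] at h
    obtain ⟨n, hn⟩ := exists_int_sub_eq_of_sin_cos_two_pi_mul_eq h.1 h.2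
    have h₁ : (-1 : ℤ) < n := by
      have : (-1 : ℝ) < n := by linarith [ht.1, hs.2]
      exact_mod_cast this
    have h₂ : n ≤ 1 := by
      have : (n : ℝ) ≤ 1 := by linarith [ht.2, hs.1]
      exact_mod_cast this
    obtain rfl | rfl : n = 0 ∨ n = 1 := by omega
    · left
      push_cast at hn
      linarith
    · right
      push_cast at hn
      constructor <;> linarith [ht.2, hs.1]
  refine ⟨fun t _ => hfg t, fun z _ => by rw [hTminus, Set.ncard_pair (hfg _)], ?_, ?_⟩
  · intro z₀ hz₀ ε hε
    set s := arg z₀ / (2 * Real.pi) with hs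
    let U : Set ℝ := {t | (dist (f t) (f s) < ε ∧ dist (g t) (g s) < ε) ∨
      (dist (f t) (g s) < ε ∧ dist (g t) (f s) < ε)}
    have hU : IsOpen U := by
      have hd : ∀ {h : ℝ → ℝ × ℝ} (_ : Continuous h) (p : ℝ × ℝ),
          IsOpen {t | dist (h t) p < ε} := fun hh p =>
        isOpen_lt (hh.dist continuous_const) continuous_const
      exact ((hd hfc _).inter (hd hgc _)).union ((hd hfc _).inter (hd hgc _))
    have hclosed : IsClosed (φ '' (Set.Icc 0 1 \ U)) :=
      ((isCompact_Icc.diff hU).image hφc).isClosed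
    have hnot : z₀ ∉ φ '' (Set.Icc 0 1 \ U) := by
      rintro ⟨t, ⟨ht, htU⟩, htz⟩
      apply htU
      rcases hinj t ht s (hmem z₀ hz₀) (htz.trans (harg_inv z₀ hz₀).symm) with h | ⟨h, h'⟩
      · left
        simp [h, hε]
      · right
        simp [h, h', hf1, hg1, hε]
    obtain ⟨δ, hδ, hball⟩ := Metric.isOpen_iff.1 hclosed.isOpen_compl z₀ hnot
    refine ⟨δ, hδ, fun z hz hzd => ?_⟩
    have hzU : arg z / (2 * Real.pi) ∈ U := by
      by_contra hcon
      exact hball hzd ⟨_, ⟨Set.Ico_subset_Icc_self (hmem z hz), hcon⟩, harg_inv z hz⟩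
    rw [hTminus, hTminus, ← hs]
    rcases hzU with h | h
    · exact (Metric.hausdorffDist_pair_le _ _ _ _).trans_lt (max_lt h.1 h.2)
    · rw [Set.pair_comm (f s)]
      exact (Metric.hausdorffDist_pair_le _ _ _ _).trans_lt (max_lt h.1 h.2)
  · rintro ⟨t₁, t₂, ht₁, -, hT⟩
    have hu : Continuous fun t => t₁ (φ t) := ht₁.comp_continuous hφc hφC
    have hval : ∀ t ∈ Set.Icc (0 : ℝ) 1, t₁ (φ t) = f t ∨ t₁ (φ t) = g t := by
      intro t ht
      have h : t₁ (φ t) ∈ Tminus (φ t) := by simp [hT _ (hφC t)]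
      rw [hTminus] at h
      rcases hinj t ht _ (hmem _ (hφC t)) (harg_inv _ (hφC t)).symm with h' | ⟨h', h''⟩
      · rwa [← h'] at h
      · rw [h'', ← hf1, ← hg1, Set.pair_comm] at h
        subst h'
        exact h
    have hsub := isPreconnected_closed_iff.1 (isPreconnected_Icc (a := (0 : ℝ)) (b := 1))
      {t | t₁ (φ t) = f t} {t | t₁ (φ t) = g t}
      (isClosed_eq hu hfc) (isClosed_eq hu hgc) hval
    have h0 : (0 : ℝ) ∈ Set.Icc (0 : ℝ) 1 := by simp
    have h1 : (1 : ℝ) ∈ Set.Icc (0 : ℝ) 1 := by simp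
    have hmeet : (Set.Icc (0 : ℝ) 1 ∩ {t | t₁ (φ t) = f t}).Nonempty ∧
        (Set.Icc (0 : ℝ) 1 ∩ {t | t₁ (φ t) = g t}).Nonempty := by
      rcases hval 0 h0 with h | h
      · exact ⟨⟨0, h0, h⟩, ⟨1, h1, by rw [Set.mem_ofPred_eq, hφ1, h, hg1]⟩⟩
      · exact ⟨⟨1, h1, by rw [Set.mem_ofPred_eq, hφ1, h, hf1]⟩, ⟨0, h0, h⟩⟩
    obtain ⟨t, -, htf, htg⟩ := hsub hmeet.1 hmeet.2
    exact hfg t (htf.symm.trans htg)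
end

section
/- Let O ⊆ ℝ^{n_x} be open, X ⊆ O compact, and let T : ℝ^{n_x} → ℝ^{n_z} (n_z ≥ n_x) be C¹ on O with DT(x) injective for every x ∈ X. Let t̄ ∈ ℝ and let x₁, x₂ : [t̄, ∞) → X be continuous functions such that T(x₁(t)) = T(x₂(t)) and x₁(t) ≠ x₂(t) for all t ≥ t̄. Then x₁ − x₂ does not converge to zero; i.e., it is not the case that ‖x₁(t) − x₂(t)‖ → 0 as t → ∞. -/
open Filter Topology in
/-- A map with an injective strict derivative on a finite-dimensional space is locally
injective. -/
theorem HasStrictFDerivAt.eventually_eq_of_injective {E F : Type*}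
    [NormedAddCommGroup E] [NormedSpace ℝ E] [FiniteDimensional ℝ E]
    [NormedAddCommGroup F] [NormedSpace ℝ F] {f : E → F} {f' : E →L[ℝ] F} {a : E}
    (hf : HasStrictFDerivAt f f' a) (hf' : Function.Injective f') :
    ∀ᶠ p : E × E in 𝓝 (a, a), f p.1 = f p.2 → p.1 = p.2 := by
  obtain ⟨K, hK, hanti⟩ :=
    LinearMap.exists_antilipschitzWith (f' : E →ₗ[ℝ] F) (LinearMap.ker_eq_bot.2 hf')
  have hK' : (0 : ℝ) < K := hK
  have hc : (0 : ℝ) < (2 * (K : ℝ))⁻¹ := by positivity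
  filter_upwards [hf.isLittleO.def hc] with p hp heq
  have hlow : ‖p.1 - p.2‖ ≤ K * ‖f' (p.1 - p.2)‖ := by
    simpa [dist_eq_norm, map_sub] using hanti.le_mul_dist p.1 p.2
  rw [heq, sub_self, zero_sub, norm_neg] at hp
  have hup : ‖p.1 - p.2‖ ≤ ‖p.1 - p.2‖ / 2 := calc
    ‖p.1 - p.2‖ ≤ K * ‖f' (p.1 - p.2)‖ := hlow
    _ ≤ K * ((2 * (K : ℝ))⁻¹ * ‖p.1 - p.2‖) := by gcongr
    _ = ‖p.1 - p.2‖ / 2 := by field_simp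
  exact sub_eq_zero.1 (norm_le_zero_iff.1 (by linarith))

/-- Two distinct continuous trajectories remaining in the compact set `X`, on which the C¹
map `T` has injective derivative, that have equal images under `T` at all times, cannot
converge to each other. -/
theorem indistinguishable_solutions_do_not_converge {nx nz : ℕ} (hnz : nx ≤ nz)
    (O : Set (EuclideanSpace ℝ (Fin nx))) (hO : IsOpen O)
    (X : Set (EuclideanSpace ℝ (Fin nx))) (hX : IsCompact X) (hXO : X ⊆ O)
    (T : EuclideanSpace ℝ (Fin nx) → EuclideanSpace ℝ (Fin nz))
    (hT : ContDiffOn ℝ 1 T O)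
    (hrank : ∀ x ∈ X, Function.Injective (fderiv ℝ T x))
    (tbar : ℝ) (x₁ x₂ : ℝ → EuclideanSpace ℝ (Fin nx))
    (hx₁c : ContinuousOn x₁ (Set.Ici tbar)) (hx₂c : ContinuousOn x₂ (Set.Ici tbar))
    (hx₁X : ∀ t, tbar ≤ t → x₁ t ∈ X) (hx₂X : ∀ t, tbar ≤ t → x₂ t ∈ X)
    (hTeq : ∀ t, tbar ≤ t → T (x₁ t) = T (x₂ t))
    (hne : ∀ t, tbar ≤ t → x₁ t ≠ x₂ t) :
    ¬ Filter.Tendsto (fun t => x₁ t - x₂ t) Filter.atTop (nhds 0) := by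
  intro hlim
  let U : Ultrafilter ℝ := Ultrafilter.of Filter.atTop
  have hU : (U : Filter ℝ) ≤ Filter.atTop := Ultrafilter.of_le _
  have hX₁ : ∀ᶠ t in (U : Filter ℝ), x₁ t ∈ X :=
    hU ((Filter.eventually_ge_atTop tbar).mono hx₁X)
  obtain ⟨a, haX, ha⟩ := hX.ultrafilter_le_nhds (U.map x₁) (Filter.le_principal_iff.2 hX₁)
  have h₁ : Filter.Tendsto x₁ U (nhds a) := ha
  have h₂ : Filter.Tendsto x₂ U (nhds a) := by
    simpa using h₁.sub (hlim.mono_left hU)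
  have hstrict : HasStrictFDerivAt T (fderiv ℝ T a) a :=
    (hT.contDiffAt (hO.mem_nhds (hXO haX))).hasStrictFDerivAt one_ne_zero
  have hinj := (h₁.prodMk_nhds h₂).eventually
    (hstrict.eventually_eq_of_injective (hrank a haX))
  obtain ⟨t, ht, htbar⟩ := (hinj.and (hU (Filter.eventually_ge_atTop tbar))).exists
  exact hne t htbar (ht (hTeq t htbar))
end
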